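/- arXiv:1801.04862 — 2 statements merged into one kernel-verified Lean document; each statement's English description precedes it below -/
import Mathlib

section
/- Let g : ℝ^(n0+n1) → Sym⁺_d(ℝ) be a C² N-log-concave function. Fix x ∈ ℝ^(n0+n1) and define the block operators Θ^g_{0,0} on M_{d,n0}(ℝ) (k-th column of Θ^g_{0,0}V equal to Σ_{j=1}^{n0} θ^g_{j,k}(x) v_j, 1 ≤ k ≤ n0), Θ^g_{1,1} on M_{d,n1}(ℝ) (k-th column equal to Σ_{j=1}^{n1} θ^g_{n0+j,n0+k}(x) w_j), and the mixed operator Θ^g_{0,1} : M_{d,n0}(ℝ) → M_{d,n1}(ℝ) whose k-th column of Θ^g_{0,1}V is Σ_{j=1}^{n0} θ^g_{j,n0+k}(x) v_j. Then for every V₀ ∈ M_{d,n0}(ℝ): ⟨−Θ^g_{0,0} V₀, V₀⟩_{id_{n0}⊗g(x)} ≥ Q°_{1,1}(Θ^g_{0,1} V₀), where Q°_{1,1} is the polar, with respect to ⟨·,·⟩_{id_{n1}⊗g(x)}, of the nonnegative quadratic form W ↦ ⟨−Θ^g_{1,1} W, W⟩_{id_{n1}⊗g(x)} on M_{d,n1}(ℝ).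 -/
open Matrix MeasureTheory

noncomputable section

/-- Entrywise partial derivative, in direction `x_j`, of a matrix-valued function. -/
def mpd {n d : ℕ} (j : Fin n) (g : (Fin n → ℝ) → Matrix (Fin d) (Fin d) ℝ)
    (x : Fin n → ℝ) : Matrix (Fin d) (Fin d) ℝ :=
  Matrix.of fun i k => fderiv ℝ (fun y => g y i k) x (Pi.single j 1)

/-- `θ^g_{j,k}(x) = g(x)⁻¹ (∂²_{x_k x_j} g(x) − (∂_{x_k} g)(x) g(x)⁻¹ (∂_{x_j} g)(x))`. -/
def theta {n d : ℕ} (g : (Fin n → ℝ) → Matrix (Fin d) (Fin d) ℝ) (j k : Fin n)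
    (x : Fin n → ℝ) : Matrix (Fin d) (Fin d) ℝ :=
  (g x)⁻¹ * (mpd k (mpd j g) x - mpd k g x * (g x)⁻¹ * mpd j g x)

/-- The operator `Θ^g(x)` on `M_{d,n}(ℝ)`: a `d×n` matrix is encoded by its columns
`U : Fin n → Fin d → ℝ`, and the `k`-th column of `Θ^g(x) U` is `Σ_j θ^g_{j,k}(x) u_j`. -/
def ThetaOp {n d : ℕ} (g : (Fin n → ℝ) → Matrix (Fin d) (Fin d) ℝ)
    (x : Fin n → ℝ) (U : Fin n → Fin d → ℝ) : Fin n → Fin d → ℝ :=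
  fun k => ∑ j, (theta g j k x).mulVec (U j)

/-- `⟨U,V⟩_{id_n ⊗ a} = Σ_k ⟨a u_k, v_k⟩` on `M_{d,n}(ℝ)` (matrices given by columns). -/
def minner {n d : ℕ} (a : Matrix (Fin d) (Fin d) ℝ)
    (U V : Fin n → Fin d → ℝ) : ℝ :=
  ∑ k, a.mulVec (U k) ⬝ᵥ V k

/-- `‖u‖²_a = ⟨a u, u⟩` on `ℝ^d`. -/
def vnormSq {d : ℕ} (a : Matrix (Fin d) (Fin d) ℝ) (u : Fin d → ℝ) : ℝ :=
  a.mulVec u ⬝ᵥ u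

/-- N-log-concavity: `⟨Θ^g(x) U, U⟩_{id_n ⊗ g(x)} ≤ 0` for all `x` and `U`. -/
def NLogConcave {n d : ℕ} (g : (Fin n → ℝ) → Matrix (Fin d) (Fin d) ℝ) : Prop :=
  ∀ (x : Fin n → ℝ) (U : Fin n → Fin d → ℝ), minner (g x) (ThetaOp g x U) U ≤ 0

/-- Entrywise `C^k` smoothness of a matrix-valued function. -/
def MatCD {n d : ℕ} (k : ℕ) (g : (Fin n → ℝ) → Matrix (Fin d) (Fin d) ℝ) : Prop :=
  ∀ i j, ContDiff ℝ k fun y => g y i j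

/-- Polar of a nonnegative quadratic form `Q` with respect to a bilinear pairing `inn`:
`Q°(v) = sup { ⟨u,v⟩² : Q(u) ≤ 1 }`. -/
def polar {E : Type*} (inn : E → E → ℝ) (Q : E → ℝ) (v : E) : ℝ :=
  sSup {r | ∃ u, Q u ≤ 1 ∧ r = inn u v ^ 2}

/-- Partial derivative `∂_{x_j} F` of a vector-valued function. -/
def pdF {n d : ℕ} (j : Fin n) (F : (Fin n → ℝ) → Fin d → ℝ) (x : Fin n → ℝ) : Fin d → ℝ :=
  fun i => fderiv ℝ (fun y => F y i) x (Pi.single j 1)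

/-- `∇_x F = [∂_{x_1} F, …, ∂_{x_n} F] ∈ M_{d,n}(ℝ)`, encoded by columns. -/
def gradM {n d : ℕ} (F : (Fin n → ℝ) → Fin d → ℝ) (x : Fin n → ℝ) :
    Fin n → Fin d → ℝ :=
  fun j => pdF j F x

/-- The operator `L F = Δ F + Σ_k (g⁻¹ ∂_{x_k} g) ∂_{x_k} F`. -/
def Lop {n d : ℕ} (g : (Fin n → ℝ) → Matrix (Fin d) (Fin d) ℝ)
    (F : (Fin n → ℝ) → Fin d → ℝ) (x : Fin n → ℝ) : Fin d → ℝ :=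
  (∑ k, pdF k (pdF k F) x) + ∑ k, ((g x)⁻¹ * mpd k g x).mulVec (pdF k F x)

/-- `Θ^g(x)` realized as a `dn × dn` matrix acting on `ℝ^{n×d} ≅ M_{d,n}(ℝ)`. -/
def ThetaMat {n d : ℕ} (g : (Fin n → ℝ) → Matrix (Fin d) (Fin d) ℝ)
    (x : Fin n → ℝ) : Matrix (Fin n × Fin d) (Fin n × Fin d) ℝ :=
  Matrix.of fun p q => theta g q.1 p.1 x p.2 q.2

/-- Identification `M_{d,n}(ℝ) → ℝ^{n×d}`. -/
def toVec {n d : ℕ} (U : Fin n → Fin d → ℝ) : Fin n × Fin d → ℝ := fun p => U p.1 p.2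

/-- Identification `ℝ^{n×d} → M_{d,n}(ℝ)`. -/
def ofVec {n d : ℕ} (v : Fin n × Fin d → ℝ) : Fin n → Fin d → ℝ := fun k i => v (k, i)

/-- The block `Θ^g_{0,0}` on `M_{d,n0}(ℝ)`. -/
def Theta00 {n0 n1 d : ℕ} (g : (Fin (n0 + n1) → ℝ) → Matrix (Fin d) (Fin d) ℝ)
    (x : Fin (n0 + n1) → ℝ) (V : Fin n0 → Fin d → ℝ) : Fin n0 → Fin d → ℝ :=
  fun k => ∑ j, (theta g (Fin.castAdd n1 j) (Fin.castAdd n1 k) x).mulVec (V j)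

/-- The mixed block `Θ^g_{0,1} : M_{d,n0}(ℝ) → M_{d,n1}(ℝ)`. -/
def Theta01 {n0 n1 d : ℕ} (g : (Fin (n0 + n1) → ℝ) → Matrix (Fin d) (Fin d) ℝ)
    (x : Fin (n0 + n1) → ℝ) (V : Fin n0 → Fin d → ℝ) : Fin n1 → Fin d → ℝ :=
  fun k => ∑ j, (theta g (Fin.castAdd n1 j) (Fin.natAdd n0 k) x).mulVec (V j)

/-- The block `Θ^g_{1,1}` on `M_{d,n1}(ℝ)`. -/
def Theta11 {n0 n1 d : ℕ} (g : (Fin (n0 + n1) → ℝ) → Matrix (Fin d) (Fin d) ℝ)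
    (x : Fin (n0 + n1) → ℝ) (W : Fin n1 → Fin d → ℝ) : Fin n1 → Fin d → ℝ :=
  fun k => ∑ j, (theta g (Fin.natAdd n0 j) (Fin.natAdd n0 k) x).mulVec (W j)

/-- The block `Θ^g_{1,1}` realized as a `d n1 × d n1` matrix. -/
def Theta11Mat {n0 n1 d : ℕ} (g : (Fin (n0 + n1) → ℝ) → Matrix (Fin d) (Fin d) ℝ)
    (x : Fin (n0 + n1) → ℝ) : Matrix (Fin n1 × Fin d) (Fin n1 × Fin d) ℝ :=
  Matrix.of fun p q => theta g (Fin.natAdd n0 q.1) (Fin.natAdd n0 p.1) x p.2 q.2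

/-- The `dn × dn` matrix `Θ̃^g(x)` with `(j,k)` block `g(x) θ^g_{j,k}(x)`. -/
def tThetaMat {n d : ℕ} (g : (Fin n → ℝ) → Matrix (Fin d) (Fin d) ℝ)
    (x : Fin n → ℝ) : Matrix (Fin n × Fin d) (Fin n × Fin d) ℝ :=
  Matrix.of fun p q => (g x * theta g q.1 p.1 x) p.2 q.2

/-- Hessian matrix of a scalar function on `ℝⁿ`. -/
def Hess {n : ℕ} (φ : (Fin n → ℝ) → ℝ) (y : Fin n → ℝ) : Matrix (Fin n) (Fin n) ℝ :=
  Matrix.of fun j k => fderiv ℝ (fun z => fderiv ℝ φ z (Pi.single k 1)) y (Pi.single j 1)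

/-- Gradient of a scalar function on `ℝⁿ`. -/
def gradV {n : ℕ} (u : (Fin n → ℝ) → ℝ) (y : Fin n → ℝ) : Fin n → ℝ :=
  fun j => fderiv ℝ u y (Pi.single j 1)

lemma Matrix.PosDef.transpose_eq {d : ℕ} {a : Matrix (Fin d) (Fin d) ℝ} (ha : a.PosDef) :
    aᵀ = a := by
  simpa [Matrix.IsHermitian, conjTranspose_eq_transpose_of_trivial] using ha.isHermitian

lemma mpd_transpose_of_symm {n d : ℕ} {g : (Fin n → ℝ) → Matrix (Fin d) (Fin d) ℝ}
    (h : ∀ y, (g y)ᵀ = g y) (j : Fin n) (x : Fin n → ℝ) : (mpd j g x)ᵀ = mpd j g x := by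
  ext i k
  have hik : (fun y => g y k i) = fun y => g y i k :=
    funext fun y => congrFun (congrFun (h y) i) k
  simp [mpd, hik]

lemma mpd_comm {n d : ℕ} {g : (Fin n → ℝ) → Matrix (Fin d) (Fin d) ℝ}
    (hg : MatCD 2 g) (j k : Fin n) (x : Fin n → ℝ) :
    mpd k (mpd j g) x = mpd j (mpd k g) x := by
  ext i l
  have hil : ContDiff ℝ 2 fun y => g y i l := hg i l
  have hdiff : DifferentiableAt ℝ (fderiv ℝ fun y => g y i l) x :=
    (hil.fderiv_right (m := 1) (by norm_num)).differentiable (by norm_num) x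
  have hsymm : IsSymmSndFDerivAt ℝ (fun y => g y i l) x :=
    hil.contDiffAt.isSymmSndFDerivAt (by simp)
  simp only [mpd, Matrix.of_apply]
  rw [fderiv_clm_apply hdiff (differentiableAt_const _),
    fderiv_clm_apply hdiff (differentiableAt_const _)]
  simpa using hsymm.eq (Pi.single k 1) (Pi.single j 1)

lemma mul_theta_transpose {n d : ℕ} {g : (Fin n → ℝ) → Matrix (Fin d) (Fin d) ℝ}
    (hg : MatCD 2 g) (hgpos : ∀ x, (g x).PosDef) (j k : Fin n) (x : Fin n → ℝ) :
    (g x * theta g j k x)ᵀ = g x * theta g k j x := by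
  have hs : ∀ y, (g y)ᵀ = g y := fun y => (hgpos y).transpose_eq
  have hm := mpd_transpose_of_symm hs
  have hmul : ∀ A, g x * ((g x)⁻¹ * A) = A :=
    fun A => Matrix.mul_nonsing_inv_cancel_left _ _ (hgpos x).det_pos.ne'.isUnit
  simp only [theta, hmul, transpose_sub, transpose_mul, transpose_nonsing_inv, hs, hm,
    mpd_comm hg j k, mpd_transpose_of_symm (hm k), Matrix.mul_assoc]

lemma mulVec_theta_dotProduct_symm {n d : ℕ} {g : (Fin n → ℝ) → Matrix (Fin d) (Fin d) ℝ}
    (hg : MatCD 2 g) (hgpos : ∀ x, (g x).PosDef) (j k : Fin n) (x : Fin n → ℝ)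
    (u v : Fin d → ℝ) :
    g x *ᵥ (theta g j k x *ᵥ u) ⬝ᵥ v = g x *ᵥ (theta g k j x *ᵥ v) ⬝ᵥ u := by
  rw [mulVec_mulVec, mulVec_mulVec, ← mul_theta_transpose hg hgpos j k x, mulVec_transpose,
    dotProduct_comm, dotProduct_mulVec]

lemma minner_comm {n d : ℕ} {a : Matrix (Fin d) (Fin d) ℝ} (ha : aᵀ = a)
    (U V : Fin n → Fin d → ℝ) : minner a U V = minner a V U := by
  refine Finset.sum_congr rfl fun k _ => ?_
  rw [dotProduct_comm, dotProduct_mulVec, ← mulVec_transpose, ha]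

lemma minner_thetaOp_append {n0 n1 d : ℕ}
    {g : (Fin (n0 + n1) → ℝ) → Matrix (Fin d) (Fin d) ℝ}
    (hg : MatCD 2 g) (hgpos : ∀ x, (g x).PosDef) (x : Fin (n0 + n1) → ℝ)
    (V : Fin n0 → Fin d → ℝ) (W : Fin n1 → Fin d → ℝ) (t : ℝ) :
    minner (g x) (ThetaOp g x (Fin.append V (t • W))) (Fin.append V (t • W)) =
      minner (g x) (Theta00 g x V) V + 2 * t * minner (g x) (Theta01 g x V) W
        + t ^ 2 * minner (g x) (Theta11 g x W) W := by
  have hcross : ∑ k : Fin n0, ∑ j : Fin n1,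
      g x *ᵥ (theta g (Fin.natAdd n0 j) (Fin.castAdd n1 k) x *ᵥ W j) ⬝ᵥ V k
      = minner (g x) (Theta01 g x V) W := by
    rw [Finset.sum_comm]
    simp only [minner, Theta01, mulVec_sum, sum_dotProduct]
    exact Finset.sum_congr rfl fun j _ => Finset.sum_congr rfl fun k _ =>
      mulVec_theta_dotProduct_symm hg hgpos _ _ _ _ _
  have hsplit : minner (g x) (ThetaOp g x (Fin.append V (t • W))) (Fin.append V (t • W)) =
      minner (g x) (Theta00 g x V) V
        + t * (∑ k : Fin n0, ∑ j : Fin n1,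
          g x *ᵥ (theta g (Fin.natAdd n0 j) (Fin.castAdd n1 k) x *ᵥ W j) ⬝ᵥ V k)
        + (t * minner (g x) (Theta01 g x V) W
          + t * (t * minner (g x) (Theta11 g x W) W)) := by
    simp only [minner, ThetaOp, Theta00, Theta01, Theta11, Fin.sum_univ_add, Fin.append_left,
      Fin.append_right, mulVec_add, mulVec_sum, add_dotProduct, sum_dotProduct, Pi.smul_apply,
      mulVec_smul, smul_dotProduct, dotProduct_smul, smul_eq_mul, Finset.sum_add_distrib,
      Finset.mul_sum]
    exact add_add_add_comm _ _ _ _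
  rw [hsplit, hcross]
  ring

/-- **Block inequality for N-log-concave weights** (polar form): for every `V₀`,
`⟨−Θ^g_{0,0} V₀, V₀⟩_{id_{n0}⊗g(x)} ≥ Q°_{1,1}(Θ^g_{0,1} V₀)`. -/
theorem block_polar_inequality (n0 n1 d : ℕ)
    (g : (Fin (n0 + n1) → ℝ) → Matrix (Fin d) (Fin d) ℝ)
    (hg : MatCD 2 g) (hgpos : ∀ x, (g x).PosDef) (hglc : NLogConcave g)
    (x : Fin (n0 + n1) → ℝ) (V0 : Fin n0 → Fin d → ℝ) :
    -minner (g x) (Theta00 g x V0) V0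
      ≥ polar (minner (g x))
          (fun W : Fin n1 → Fin d → ℝ => -minner (g x) (Theta11 g x W) W)
          (Theta01 g x V0) := by
  have hquad : ∀ (W : Fin n1 → Fin d → ℝ) (t : ℝ),
      minner (g x) (Theta00 g x V0) V0 + 2 * t * minner (g x) (Theta01 g x V0) W
        + t ^ 2 * minner (g x) (Theta11 g x W) W ≤ 0 := fun W t => by
    rw [← minner_thetaOp_append hg hgpos]
    exact hglc x _
  refine Real.sSup_le ?_ ?_
  · rintro _ ⟨W, hW, rfl⟩
    rw [minner_comm (hgpos x).transpose_eq]
    have h := hquad W (minner (g x) (Theta01 g x V0) W)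
    nlinarith [mul_le_mul_of_nonneg_left hW (sq_nonneg (minner (g x) (Theta01 g x V0) W))]
  · have h := hquad 0 0
    linarith

end
end

section
/- Let g : ℝⁿ → Sym⁺_d(ℝ) be C³ (so that Θ^g is defined and the computation below makes sense), and define LF := ΔF + Σ_{k=1}^n (g⁻¹ ∂_{x_k} g) ∂_{x_k} F. If F : ℝⁿ → ℝ^d is C³ (or C² with the stated integrals finite) and compactly supported, then ∫_{ℝⁿ} ‖LF(x)‖²_{g(x)} dx = ∫_{ℝⁿ} ⟨−Θ^g(x) ∇_x F, ∇_x F⟩_{id_n⊗g(x)} dx + ∫_{ℝⁿ} Σ_{j,k=1}^n ‖∂²_{x_j x_k} F‖²_{g(x)} dx. -/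
open Matrix MeasureTheory

noncomputable section

variable {n d : ℕ}

theorem contDiff_pdF {m : ℕ} {F : (Fin n → ℝ) → Fin d → ℝ} (hF : ContDiff ℝ (m + 1 : ℕ) F)
    (j : Fin n) : ContDiff ℝ m (pdF j F) := by
  rw [contDiff_pi] at hF ⊢
  intro i
  exact ((hF i).fderiv_right (m := m) (by norm_cast)).clm_apply contDiff_const

theorem MatCD.mpd {m : ℕ} {g : (Fin n → ℝ) → Matrix (Fin d) (Fin d) ℝ} (hg : MatCD (m + 1) g)
    (j : Fin n) : MatCD m (mpd j g) := fun i k =>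
  ((hg i k).fderiv_right (m := m) (by norm_cast)).clm_apply contDiff_const

theorem MatCD.continuous {m : ℕ} {g : (Fin n → ℝ) → Matrix (Fin d) (Fin d) ℝ} (hg : MatCD m g) :
    Continuous g :=
  continuous_matrix fun i k => (hg i k).continuous

theorem mpd_isSymm {g : (Fin n → ℝ) → Matrix (Fin d) (Fin d) ℝ} (hg : ∀ x, (g x).IsSymm)
    (j : Fin n) (x : Fin n → ℝ) : (mpd j g x).IsSymm := by
  ext i k
  simp only [mpd, transpose_apply, of_apply]
  simp_rw [fun y => (hg y).apply i k]

theorem pdF_comm {F : (Fin n → ℝ) → Fin d → ℝ} (hF : ContDiff ℝ 2 F) (j k : Fin n) :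
    pdF j (pdF k F) = pdF k (pdF j F) := by
  rw [contDiff_pi] at hF
  ext x i
  have hd : Differentiable ℝ (fderiv ℝ fun y => F y i) :=
    ((hF i).fderiv_right (m := 1) (by norm_num)).differentiable (by norm_num)
  have hsymm := (hF i).contDiffAt (x := x) |>.isSymmSndFDerivAt (by simp)
  simp only [pdF]
  rw [fderiv_clm_apply (hd x) (differentiableAt_const _),
    fderiv_clm_apply (hd x) (differentiableAt_const _)]
  simpa using hsymm (Pi.single j 1) (Pi.single k 1)

theorem tsupport_pdF_subset (F : (Fin n → ℝ) → Fin d → ℝ) (j : Fin n) :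
    tsupport (pdF j F) ⊆ tsupport F := by
  refine closure_minimal (fun x hx => ?_) (isClosed_tsupport F)
  by_contra hxF
  apply hx
  ext i
  have hFi : (fun y => F y i) =ᶠ[nhds x] fun _ => (0 : ℝ) := by
    filter_upwards [notMem_tsupport_iff_eventuallyEq.1 hxF] with y hy
    simp [hy]
  simp [pdF, hFi.fderiv_eq]

theorem pdF_eq_zero_of_notMem_tsupport {F : (Fin n → ℝ) → Fin d → ℝ} {x : Fin n → ℝ}
    (hx : x ∉ tsupport F) (j : Fin n) : pdF j F x = 0 :=
  image_eq_zero_of_notMem_tsupport fun h => hx (tsupport_pdF_subset F j h)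

theorem contDiff_mulVec_dotProduct {m : ℕ} {A : (Fin n → ℝ) → Matrix (Fin d) (Fin d) ℝ}
    {u v : (Fin n → ℝ) → Fin d → ℝ} (hA : MatCD m A) (hu : ContDiff ℝ m u)
    (hv : ContDiff ℝ m v) : ContDiff ℝ m fun x => A x *ᵥ u x ⬝ᵥ v x := by
  rw [contDiff_pi] at hu hv
  simp only [dotProduct, mulVec]
  exact ContDiff.sum fun i _ => (ContDiff.sum fun k _ => (hA i k).mul (hu k)).mul (hv i)

theorem fderiv_mulVec_dotProduct {A : (Fin n → ℝ) → Matrix (Fin d) (Fin d) ℝ}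
    {u v : (Fin n → ℝ) → Fin d → ℝ} (hA : MatCD 1 A) (hu : ContDiff ℝ 1 u)
    (hv : ContDiff ℝ 1 v) (j : Fin n) (x : Fin n → ℝ) :
    fderiv ℝ (fun y => A y *ᵥ u y ⬝ᵥ v y) x (Pi.single j 1)
      = mpd j A x *ᵥ u x ⬝ᵥ v x + A x *ᵥ pdF j u x ⬝ᵥ v x + A x *ᵥ u x ⬝ᵥ pdF j v x := by
  rw [contDiff_pi] at hu hv
  have hA' i k := ((hA i k).differentiable (by norm_num) x).hasFDerivAt
  have hu' i := ((hu i).differentiable (by norm_num) x).hasFDerivAt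
  have hv' i := ((hv i).differentiable (by norm_num) x).hasFDerivAt
  have h := HasFDerivAt.fun_sum (u := Finset.univ) fun i _ =>
    (HasFDerivAt.fun_sum (u := Finset.univ) fun k _ => (hA' i k).mul (hu' k)).mul (hv' i)
  simp only [dotProduct, mulVec]
  refine (congrArg (fun L => L (Pi.single j 1)) h.fderiv).trans ?_
  simp only [_root_.sum_apply, _root_.add_apply, _root_.smul_apply, Pi.mul_apply, smul_eq_mul,
    mpd, pdF, of_apply, ← Finset.sum_add_distrib]
  refine Finset.sum_congr rfl fun i _ => ?_
  rw [Finset.sum_add_distrib]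
  simp only [mul_comm (u x _)]
  ring

theorem integral_fderiv_eq_zero {f : (Fin n → ℝ) → ℝ} (hf : ContDiff ℝ 1 f)
    (hc : HasCompactSupport f) (v : Fin n → ℝ) : ∫ x, fderiv ℝ f x v = 0 := by
  have hd : Integrable (fun x => fderiv ℝ f x v) :=
    ((hf.continuous_fderiv (by norm_num)).clm_apply continuous_const).integrable_of_hasCompactSupport
      (hc.fderiv_apply ℝ v)
  have h := integral_mul_fderiv_eq_neg_fderiv_mul_of_integrable (μ := volume)
    (f := fun _ : Fin n → ℝ => (1 : ℝ)) (g := f) (v := v) (by simp) (by simpa using hd)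
    (by simpa using hf.continuous.integrable_of_hasCompactSupport hc)
    (fun _ _ => differentiableAt_const _) fun x _ => hf.differentiable (by norm_num) x
  simpa using h

theorem continuous_matrix_inv {A : (Fin n → ℝ) → Matrix (Fin d) (Fin d) ℝ} (hA : Continuous A)
    (h : ∀ x, IsUnit (A x).det) : Continuous fun x => (A x)⁻¹ := by
  simp only [inv_def, Ring.inverse_eq_inv']
  exact (hA.matrix_det.inv₀ fun x => (h x).ne_zero).smul hA.matrix_adjugate

theorem mulVec_dotProduct_comm {A : Matrix (Fin d) (Fin d) ℝ} (hA : A.IsSymm) (u v : Fin d → ℝ) :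
    A *ᵥ u ⬝ᵥ v = A *ᵥ v ⬝ᵥ u := by
  rw [dotProduct_comm, dotProduct_mulVec, ← mulVec_transpose, hA.eq]

theorem vnormSq_Lop {g : (Fin n → ℝ) → Matrix (Fin d) (Fin d) ℝ} (hs : ∀ x, (g x).IsSymm)
    {x : Fin n → ℝ} (hu : IsUnit (g x).det) (F : (Fin n → ℝ) → Fin d → ℝ) :
    vnormSq (g x) (Lop g F x)
      = ∑ j, ∑ k, (g x *ᵥ pdF j (pdF j F) x ⬝ᵥ pdF k (pdF k F) x
        + 2 * (mpd j g x *ᵥ pdF j F x ⬝ᵥ pdF k (pdF k F) x)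
        + mpd j g x *ᵥ pdF j F x ⬝ᵥ (g x)⁻¹ *ᵥ mpd k g x *ᵥ pdF k F x) := by
  set p := ∑ k, mpd k g x *ᵥ pdF k F x with hp
  set u := ∑ k, pdF k (pdF k F) x with hu'
  have hL : Lop g F x = u + (g x)⁻¹ *ᵥ p := by
    simp only [Lop, hp, mulVec_sum, mulVec_mulVec, u]
  have hgp : g x *ᵥ (g x)⁻¹ *ᵥ p = p := by
    rw [mulVec_mulVec, mul_nonsing_inv _ hu, one_mulVec]
  have hcross : g x *ᵥ u ⬝ᵥ (g x)⁻¹ *ᵥ p = p ⬝ᵥ u := by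
    rw [mulVec_dotProduct_comm (hs x), hgp]
  have h : vnormSq (g x) (Lop g F x)
      = g x *ᵥ u ⬝ᵥ u + 2 * (p ⬝ᵥ u) + p ⬝ᵥ (g x)⁻¹ *ᵥ p := by
    rw [hL, vnormSq, mulVec_add, hgp, add_dotProduct, dotProduct_add, dotProduct_add, hcross]
    ring
  rw [h, hp, hu']
  simp only [mulVec_sum, sum_dotProduct]
  simp only [dotProduct_sum, Finset.sum_add_distrib, Finset.mul_sum]

theorem minner_ThetaOp {g : (Fin n → ℝ) → Matrix (Fin d) (Fin d) ℝ} (hs : ∀ x, (g x).IsSymm)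
    {x : Fin n → ℝ} (hu : IsUnit (g x).det) (U : Fin n → Fin d → ℝ) :
    minner (g x) (ThetaOp g x U) U
      = ∑ j, ∑ k, (mpd k (mpd j g) x *ᵥ U j ⬝ᵥ U k
        - mpd j g x *ᵥ U j ⬝ᵥ (g x)⁻¹ *ᵥ mpd k g x *ᵥ U k) := by
  have hi : (g x)⁻¹.IsSymm := by rw [IsSymm, transpose_nonsing_inv, (hs x).eq]
  rw [Finset.sum_comm]
  simp only [minner, ThetaOp, mulVec_sum, sum_dotProduct]
  refine Finset.sum_congr rfl fun k _ => Finset.sum_congr rfl fun j _ => ?_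
  rw [theta, mulVec_mulVec, mul_nonsing_inv_cancel_left _ _ hu, sub_mulVec, sub_dotProduct,
    ← mulVec_mulVec, ← mulVec_mulVec, mulVec_dotProduct_comm (mpd_isSymm hs k x),
    dotProduct_comm (mpd k g x *ᵥ U k), mulVec_dotProduct_comm hi,
    dotProduct_comm ((g x)⁻¹ *ᵥ _)]

theorem vnormSq_Lop_eq_add_divergence {g : (Fin n → ℝ) → Matrix (Fin d) (Fin d) ℝ}
    (hg : MatCD 2 g) (hs : ∀ x, (g x).IsSymm) {x : Fin n → ℝ} (hu : IsUnit (g x).det)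
    {F : (Fin n → ℝ) → Fin d → ℝ} (hF : ContDiff ℝ 3 F) :
    vnormSq (g x) (Lop g F x)
      = -minner (g x) (ThetaOp g x (gradM F x)) (gradM F x)
        + ∑ j, ∑ k, vnormSq (g x) (pdF k (pdF j F) x)
        + ∑ j, ∑ k,
          (fderiv ℝ (fun y => g y *ᵥ pdF j F y ⬝ᵥ pdF k (pdF k F) y) x (Pi.single j 1)
          - fderiv ℝ (fun y => g y *ᵥ pdF j F y ⬝ᵥ pdF k (pdF j F) y) x (Pi.single k 1)
          + fderiv ℝ (fun y => mpd j g y *ᵥ pdF j F y ⬝ᵥ pdF k F y) x (Pi.single k 1)) := by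
  have h1 j : ContDiff ℝ 2 (pdF j F) := contDiff_pdF (m := 2) hF j
  have h1' j : ContDiff ℝ 1 (pdF j F) := (h1 j).of_le (by norm_num)
  have h2 j k : ContDiff ℝ 1 (pdF k (pdF j F)) := contDiff_pdF (m := 1) (h1 j) k
  have hg1 : MatCD 1 g := fun i k => (hg i k).of_le (by norm_num)
  have hthird : ∑ j, ∑ k, g x *ᵥ pdF j F x ⬝ᵥ pdF j (pdF k (pdF k F)) x
      = ∑ j, ∑ k, g x *ᵥ pdF j F x ⬝ᵥ pdF k (pdF k (pdF j F)) x := by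
    refine Finset.sum_congr rfl fun j _ => Finset.sum_congr rfl fun k _ => ?_
    rw [pdF_comm (h1 k) j k, pdF_comm (hF.of_le (by norm_num)) j k]
  have hmixed : ∑ j, ∑ k, mpd k g x *ᵥ pdF j F x ⬝ᵥ pdF k (pdF j F) x
      = ∑ j, ∑ k, mpd j g x *ᵥ pdF k (pdF j F) x ⬝ᵥ pdF k F x := by
    rw [Finset.sum_comm]
    refine Finset.sum_congr rfl fun j _ => Finset.sum_congr rfl fun k _ => ?_
    rw [mulVec_dotProduct_comm (mpd_isSymm hs j x), pdF_comm (hF.of_le (by norm_num)) j k]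
  rw [vnormSq_Lop hs hu]
  simp only [minner_ThetaOp hs hu, fderiv_mulVec_dotProduct hg1 (h1' _) (h2 _ _),
    fderiv_mulVec_dotProduct (hg.mpd _) (h1' _) (h1' _), hthird, gradM, vnormSq,
    Finset.sum_add_distrib, Finset.sum_sub_distrib, ← Finset.mul_sum, hmixed]
  ring

theorem integrable_of_eq_zero_off_tsupport {F : (Fin n → ℝ) → Fin d → ℝ}
    (hF : HasCompactSupport F) {f : (Fin n → ℝ) → ℝ} (hf : Continuous f)
    (h : ∀ x ∉ tsupport F, f x = 0) : Integrable f :=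
  hf.integrable_of_hasCompactSupport (HasCompactSupport.intro hF.isCompact h)

/-- **Bochner-type formula**: for a compactly supported `C³` function `F`,
`∫ ‖LF‖²_g = ∫ ⟨−Θ^g ∇F, ∇F⟩_{id_n⊗g} + ∫ Σ_{j,k} ‖∂²_{jk}F‖²_g`. -/
theorem weighted_bochner_formula (n d : ℕ)
    (g : (Fin n → ℝ) → Matrix (Fin d) (Fin d) ℝ)
    (hg : MatCD 3 g) (hgpos : ∀ x, (g x).PosDef)
    (F : (Fin n → ℝ) → Fin d → ℝ)
    (hF : ContDiff ℝ 3 F) (hFc : HasCompactSupport F) :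
    ∫ x : Fin n → ℝ, vnormSq (g x) (Lop g F x)
      = (∫ x : Fin n → ℝ, -minner (g x) (ThetaOp g x (gradM F x)) (gradM F x))
        + ∫ x : Fin n → ℝ, ∑ j : Fin n, ∑ k : Fin n, vnormSq (g x) (pdF k (pdF j F) x) := by
  have hs x : (g x).IsSymm := by simpa using (hgpos x).isHermitian
  have hu x : IsUnit (g x).det := (hgpos x).det_pos.ne'.isUnit
  have hg2 : MatCD 2 g := fun i k => (hg i k).of_le (by norm_num)
  have hg1 : MatCD 1 g := fun i k => (hg i k).of_le (by norm_num)
  have h1 j : ContDiff ℝ 2 (pdF j F) := contDiff_pdF (m := 2) hF j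
  have h1' j : ContDiff ℝ 1 (pdF j F) := (h1 j).of_le (by norm_num)
  have h2 j k : ContDiff ℝ 1 (pdF k (pdF j F)) := contDiff_pdF (m := 1) (h1 j) k
  have hz {x} (hx : x ∉ tsupport F) j : pdF j F x = 0 := pdF_eq_zero_of_notMem_tsupport hx j
  have hz2 {x} (hx : x ∉ tsupport F) j k : pdF k (pdF j F) x = 0 :=
    pdF_eq_zero_of_notMem_tsupport (fun h => hx (tsupport_pdF_subset F j h)) k
  have hΘ : Integrable fun x => -minner (g x) (ThetaOp g x (gradM F x)) (gradM F x) := by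
    refine integrable_of_eq_zero_off_tsupport hFc ?_ fun x hx => ?_
    · have c0 := hg.continuous
      have ci := continuous_matrix_inv c0 hu
      have c1 j := (hg2.mpd (m := 1) j).continuous
      have c2 j k := ((hg2.mpd (m := 1) j).mpd (m := 0) k).continuous
      have cF j := (h1 j).continuous
      simp only [fun x => minner_ThetaOp hs (hu x), gradM]
      exact (continuous_finsetSum _ fun j _ => continuous_finsetSum _ fun k _ =>
        (((c2 j k).matrix_mulVec (cF j)).dotProduct (cF k)).sub
          (((c1 j).matrix_mulVec (cF j)).dotProduct
            (ci.matrix_mulVec ((c1 k).matrix_mulVec (cF k))))).neg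
    · simp [minner, gradM, hz hx]
  have hH : Integrable fun x => ∑ j, ∑ k, vnormSq (g x) (pdF k (pdF j F) x) := by
    refine integrable_of_eq_zero_off_tsupport hFc ?_ fun x hx => ?_
    · exact continuous_finsetSum _ fun j _ => continuous_finsetSum _ fun k _ =>
        (contDiff_mulVec_dotProduct hg1 (h2 j k) (h2 j k)).continuous
    · simp [vnormSq, hz2 hx]
  have hdiv {A : (Fin n → ℝ) → Matrix (Fin d) (Fin d) ℝ} {v : (Fin n → ℝ) → Fin d → ℝ}
      (hA : MatCD 1 A) (hv : ContDiff ℝ 1 v) (j i : Fin n) :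
      Integrable (fun x => fderiv ℝ (fun y => A y *ᵥ pdF j F y ⬝ᵥ v y) x (Pi.single i 1)) ∧
        ∫ x, fderiv ℝ (fun y => A y *ᵥ pdF j F y ⬝ᵥ v y) x (Pi.single i 1) = 0 := by
    have hc : HasCompactSupport fun y => A y *ᵥ pdF j F y ⬝ᵥ v y :=
      HasCompactSupport.intro hFc.isCompact fun x hx => by simp [hz hx]
    have hd := contDiff_mulVec_dotProduct hA (h1' j) hv
    exact ⟨((hd.continuous_fderiv (by norm_num)).clm_apply
      continuous_const).integrable_of_hasCompactSupport (hc.fderiv_apply ℝ _),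
      integral_fderiv_eq_zero hd hc _⟩
  have hD1 j k := hdiv hg1 (h2 k k) j j
  have hD2 j k := hdiv hg1 (h2 j k) j k
  have hD3 j k := hdiv (hg2.mpd j) (h1' k) j k
  have hDi j k := ((hD1 j k).1.sub' (hD2 j k).1).fun_add (hD3 j k).1
  have hDs j := integrable_finsetSum Finset.univ fun k _ => hDi j k
  simp only [fun x => vnormSq_Lop_eq_add_divergence hg2 hs (hu x) hF]
  rw [integral_add (hΘ.fun_add hH) (integrable_finsetSum _ fun j _ => hDs j), integral_add hΘ hH,
    integral_finsetSum _ fun j _ => hDs j]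
  refine add_eq_left.2 (Finset.sum_eq_zero fun j _ => ?_)
  rw [integral_finsetSum _ fun k _ => hDi j k]
  refine Finset.sum_eq_zero fun k _ => ?_
  rw [integral_add ((hD1 j k).1.sub' (hD2 j k).1) (hD3 j k).1,
    integral_sub (hD1 j k).1 (hD2 j k).1, (hD1 j k).2, (hD2 j k).2, (hD3 j k).2]
  norm_num

end
end
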